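/- Let r,s,n be positive integers with n ≥ r+s. (a) The map φ sending (f,λ)∈Λ_{r,s} with λ=(λ⁽¹⁾,λ⁽²⁾), ℓ(λ⁽¹⁾)=k, ℓ(λ⁽²⁾)=l, to (λ⁽¹⁾₁,…,λ⁽¹⁾_k,0,…,0,−λ⁽²⁾_l,…,−λ⁽²⁾₁) ∈ Zⁿ is a bijection from Λ_{r,s} onto Λ⁺(r,s) = Λ(r,s) ∩ X⁺(n). (b) The set Λ = {λ + sω : λ ∈ Λ⁺(r,s)}, where ω=(1,1,…,1) ∈ Zⁿ, is an ideal of Λ⁺(n, r+(n−1)s) under the dominance order: if μ ∈ Λ, α ∈ Λ⁺(n,r+(n−1)s) and α ⊴ μ, then α ∈ Λ. -/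

import Mathlib

open scoped BigOperators

/-! ### Combinatorics: bipartitions, rows, restriction -/

/-- The indexing poset `Λ_{r,s}`: pairs `(f, (λ¹, λ²))` with `0 ≤ f ≤ min r s`,
`λ¹ ⊢ r - f` and `λ² ⊢ s - f`. -/
structure LambdaRS (r s : ℕ) where
  f : ℕ
  hf : f ≤ min r s
  lam1 : (r - f).Partition
  lam2 : (s - f).Partition

/-- The `i`-th row (0-indexed) of a partition, i.e. `λ_{i+1}`. -/
noncomputable def partRow {m : ℕ} (p : m.Partition) (i : ℕ) : ℕ :=
  ((p.parts.sort (· ≤ ·)).reverse).getD i 0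

/-- The `i`-th row of the conjugate partition: the number of parts `> i`. -/
noncomputable def conjRow {m : ℕ} (p : m.Partition) (i : ℕ) : ℕ :=
  (p.parts.filter (fun a => i < a)).card

/-- The conjugate (transposed) partition. -/
noncomputable def conjPartition {m : ℕ} (p : m.Partition) : m.Partition where
  parts := ((Multiset.range m).map (fun i => conjRow p i)).filter (fun a => 0 < a)
  parts_pos := by
    intro a ha
    exact (Multiset.mem_filter.1 ha).2
  parts_sum := by
    classical
    have hb : ∀ a ∈ p.parts, a ≤ m := by
      intro a ha
      have := Multiset.single_le_sum (fun x _ => Nat.zero_le x) a ha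
      simpa [p.parts_sum] using this
    have key : ∀ t : Multiset ℕ, (∀ a ∈ t, a ≤ m) →
        (∑ i ∈ Finset.range m, (t.filter (fun a => i < a)).card) = t.sum := by
      intro t
      induction t using Multiset.induction_on with
      | empty => intro _; simp
      | cons a t ih =>
        intro hbd
        have ha : a ≤ m := hbd a (Multiset.mem_cons_self a t)
        have ht : ∀ x ∈ t, x ≤ m := fun x hx => hbd x (Multiset.mem_cons_of_mem hx)
        have hsplit : ∀ i, ((a ::ₘ t).filter (fun b => i < b)).card
            = (t.filter (fun b => i < b)).card + (if i < a then 1 else 0) := by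
          intro i
          by_cases h : i < a <;> simp [Multiset.filter_cons, h, add_comm]
        have hite : (∑ i ∈ Finset.range m, (if i < a then 1 else 0)) = a := by
          have hfil : (Finset.range m).filter (fun i => i < a) = Finset.range a := by
            ext x
            simp only [Finset.mem_filter, Finset.mem_range]
            omega
          rw [Finset.sum_boole]
          simp [hfil]
        calc (∑ i ∈ Finset.range m, ((a ::ₘ t).filter (fun b => i < b)).card)
            = ∑ i ∈ Finset.range m,
                ((t.filter (fun b => i < b)).card + (if i < a then 1 else 0)) :=
              Finset.sum_congr rfl fun i _ => hsplit i
          _ = t.sum + a := by rw [Finset.sum_add_distrib, ih ht, hite]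
          _ = (a ::ₘ t).sum := by simp [Multiset.sum_cons, add_comm]
    have h0 : (((Multiset.range m).map (fun i => conjRow p i)).filter (fun a => 0 < a)).sum
        = (((Multiset.range m).map (fun i => conjRow p i))).sum := by
      rw [← Multiset.sum_filter_add_sum_filter_not
        (s := (Multiset.range m).map (fun i => conjRow p i)) (p := fun a => 0 < a)]
      have hz : (((Multiset.range m).map (fun i => conjRow p i)).filter
          (fun a => ¬ 0 < a)).sum = 0 := by
        apply Multiset.sum_eq_zero
        intro x hx
        have := (Multiset.mem_filter.1 hx).2
        omega
      omega
    have h1 : (((Multiset.range m).map (fun i => conjRow p i))).sum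
        = ∑ i ∈ Finset.range m, conjRow p i := by
      rw [Finset.sum_eq_multiset_sum]
      rfl
    rw [h0, h1]
    unfold conjRow
    rw [key p.parts hb, p.parts_sum]

/-- A partition is `e`-restricted if `λ_i - λ_{i+1} < e` for all `i`. -/
def PartERestricted (e : ℕ∞) {m : ℕ} (p : m.Partition) : Prop :=
  ∀ i : ℕ, ((partRow p i - partRow p (i + 1) : ℕ) : ℕ∞) < e

/-- A bipartition is `e`-restricted if both components are. -/
def ERestricted (e : ℕ∞) {r s : ℕ} (l : LambdaRS r s) : Prop :=
  PartERestricted e l.lam1 ∧ PartERestricted e l.lam2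

/-- The componentwise conjugate of an element of `Λ_{r,s}`. -/
noncomputable def conjL {r s : ℕ} (l : LambdaRS r s) : LambdaRS r s :=
  ⟨l.f, l.hf, conjPartition l.lam1, conjPartition l.lam2⟩

/-- `1 + q² + ⋯ + q^{2(n-1)}`. -/
def quantumSum {κ : Type} [Field κ] (q : κ) (n : ℕ) : κ :=
  ∑ i ∈ Finset.range n, q ^ (2 * i)

/-- `e` is the quantum characteristic of `q`: the least positive integer `e` with
`1 + q² + ⋯ + q^{2(e-1)} = 0`, or `∞` if there is none. -/
def IsQuantumChar {κ : Type} [Field κ] (q : κ) (e : ℕ∞) : Prop :=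
  0 < e ∧ (∀ n : ℕ, 0 < n → (n : ℕ∞) < e → quantumSum q n ≠ 0) ∧
    ∀ n : ℕ, (n : ℕ∞) = e → quantumSum q n = 0

/-! ### The quantized walled Brauer algebra, by generators and relations -/

/-- Generators of the quantized walled Brauer algebra `ℬ_{r,s}`:
`E = e₁`, `G i = g_{i+1}` (`0 ≤ i < r-1`), `Gs j = g*_{j+1}` (`0 ≤ j < s-1`). -/
inductive WBGen (r s : ℕ) : Type
  | E : WBGen r s
  | G : Fin (r - 1) → WBGen r s
  | Gs : Fin (s - 1) → WBGen r s

namespace WalledBrauerAux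

variable (κ : Type) [Field κ] (r s : ℕ)

noncomputable def g (i : Fin (r - 1)) : FreeAlgebra κ (WBGen r s) :=
  FreeAlgebra.ι κ (WBGen.G i)

noncomputable def gs (j : Fin (s - 1)) : FreeAlgebra κ (WBGen r s) :=
  FreeAlgebra.ι κ (WBGen.Gs j)

noncomputable def ee : FreeAlgebra κ (WBGen r s) :=
  FreeAlgebra.ι κ WBGen.E

noncomputable def cc (x : κ) : FreeAlgebra κ (WBGen r s) :=
  algebraMap κ _ x

/-- `g₁⁻¹ = g₁ - (q - q⁻¹)`. -/
noncomputable def giv (q : κˣ) (i : Fin (r - 1)) : FreeAlgebra κ (WBGen r s) :=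
  g κ r s i - cc κ r s ((q : κ) - ((q⁻¹ : κˣ) : κ))

end WalledBrauerAux

/-- `δ = (ρ - ρ⁻¹)/(q - q⁻¹)`. -/
noncomputable def wbDelta {κ : Type} [Field κ] (q ρ : κˣ) : κ :=
  ((ρ : κ) - ((ρ⁻¹ : κˣ) : κ)) / ((q : κ) - ((q⁻¹ : κˣ) : κ))

open WalledBrauerAux in
/-- Defining relations of the quantized walled Brauer algebra `ℬ_{r,s}` with parameters
`ρ` and `q` (Leduc's presentation, as in Section 2 of the paper). -/
inductive WBRel (κ : Type) [Field κ] (q ρ : κˣ) (r s : ℕ) :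
    FreeAlgebra κ (WBGen r s) → FreeAlgebra κ (WBGen r s) → Prop
  | heckeG (i : Fin (r - 1)) :
      WBRel κ q ρ r s ((g κ r s i - cc κ r s (q : κ)) * (g κ r s i + cc κ r s ((q⁻¹ : κˣ) : κ))) 0
  | heckeGs (j : Fin (s - 1)) :
      WBRel κ q ρ r s ((gs κ r s j - cc κ r s (q : κ)) * (gs κ r s j + cc κ r s ((q⁻¹ : κˣ) : κ))) 0
  | braidG (i j : Fin (r - 1)) (h : (j : ℕ) = (i : ℕ) + 1) :
      WBRel κ q ρ r s (g κ r s i * g κ r s j * g κ r s i) (g κ r s j * g κ r s i * g κ r s j)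
  | braidGs (i j : Fin (s - 1)) (h : (j : ℕ) = (i : ℕ) + 1) :
      WBRel κ q ρ r s (gs κ r s i * gs κ r s j * gs κ r s i) (gs κ r s j * gs κ r s i * gs κ r s j)
  | commG (i j : Fin (r - 1)) (h : (i : ℕ) + 1 < (j : ℕ)) :
      WBRel κ q ρ r s (g κ r s i * g κ r s j) (g κ r s j * g κ r s i)
  | commGs (i j : Fin (s - 1)) (h : (i : ℕ) + 1 < (j : ℕ)) :
      WBRel κ q ρ r s (gs κ r s i * gs κ r s j) (gs κ r s j * gs κ r s i)
  | commGGs (i : Fin (r - 1)) (j : Fin (s - 1)) :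
      WBRel κ q ρ r s (g κ r s i * gs κ r s j) (gs κ r s j * g κ r s i)
  | eG (i : Fin (r - 1)) (h : (i : ℕ) ≠ 0) :
      WBRel κ q ρ r s (g κ r s i * ee κ r s) (ee κ r s * g κ r s i)
  | eGs (j : Fin (s - 1)) (h : (j : ℕ) ≠ 0) :
      WBRel κ q ρ r s (gs κ r s j * ee κ r s) (ee κ r s * gs κ r s j)
  | eg1e (i : Fin (r - 1)) (h : (i : ℕ) = 0) :
      WBRel κ q ρ r s (ee κ r s * g κ r s i * ee κ r s) (cc κ r s (ρ : κ) * ee κ r s)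
  | egs1e (j : Fin (s - 1)) (h : (j : ℕ) = 0) :
      WBRel κ q ρ r s (ee κ r s * gs κ r s j * ee κ r s) (cc κ r s (ρ : κ) * ee κ r s)
  | ee2 : WBRel κ q ρ r s (ee κ r s * ee κ r s) (cc κ r s (wbDelta q ρ) * ee κ r s)
  | rel5 (i : Fin (r - 1)) (hi : (i : ℕ) = 0) (j : Fin (s - 1)) (hj : (j : ℕ) = 0) :
      WBRel κ q ρ r s (ee κ r s * giv κ r s q i * gs κ r s j * ee κ r s * g κ r s i)
        (ee κ r s * giv κ r s q i * gs κ r s j * ee κ r s * gs κ r s j)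
  | rel6 (i : Fin (r - 1)) (hi : (i : ℕ) = 0) (j : Fin (s - 1)) (hj : (j : ℕ) = 0) :
      WBRel κ q ρ r s (g κ r s i * ee κ r s * giv κ r s q i * gs κ r s j * ee κ r s)
        (gs κ r s j * ee κ r s * giv κ r s q i * gs κ r s j * ee κ r s)

/-- The quantized walled Brauer algebra `ℬ_{r,s,κ}` over `κ` with parameters `ρ, q`. -/
abbrev WalledBrauer (κ : Type) [Field κ] (q ρ : κˣ) (r s : ℕ) : Type :=
  RingQuot (WBRel κ q ρ r s)

/-! ### Composition series and multiplicities -/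

/-- A composition series of the full module: from `⊥` to `⊤`. -/
def IsFullSeries {A : Type} [Ring A] {M : Type} [AddCommGroup M] [Module A M]
    (σ : CompositionSeries (Submodule A M)) : Prop :=
  σ.head = ⊥ ∧ σ.last = ⊤

/-- The number of factors of the series `σ` isomorphic to the module `D`:
the multiplicity `[M : D]` of `D` as a composition factor. -/
noncomputable def seriesFactorMult (A : Type) [Ring A] {M : Type} [AddCommGroup M] [Module A M]
    (σ : CompositionSeries (Submodule A M)) (D : Type) [AddCommGroup D] [Module A D] : ℕ :=
  Nat.card {i : Fin σ.length //
    Nonempty ((↥(σ i.succ) ⧸ (Submodule.comap (σ i.succ).subtype (σ i.castSucc))) ≃ₗ[A] D)}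

/-- `D` is a composition factor of `M`, i.e. `D` is isomorphic to a subquotient of `M`. -/
def IsCompositionFactor (A : Type) [Ring A] (M : Type) [AddCommGroup M] [Module A M]
    (D : Type) [AddCommGroup D] [Module A D] : Prop :=
  ∃ p q : Submodule A M, p ≤ q ∧
    Nonempty ((↥q ⧸ (Submodule.comap q.subtype p)) ≃ₗ[A] D)

/-! ### Cell data for the walled Brauer algebra -/

/-- The cell-module data of the cellular algebra `ℬ_{r,s,κ}` (Graham–Lehrer):
for each `(f,λ) ∈ Λ_{r,s}` the right cell module `C (f,λ)` (a module over `ℬᵐᵒᵖ`),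
its quotient `D (f,λ) = C(f,λ)/rad φ_{f,λ}`, which is absolutely irreducible or zero;
the nonzero `D`'s (those with `e`-restricted index) are pairwise non-isomorphic. -/
structure CellDatum (κ : Type) [Field κ] (q ρ : κˣ) (r s : ℕ) (e : ℕ∞) where
  C : LambdaRS r s → Type
  [instAddC : ∀ l, AddCommGroup (C l)]
  [instModC : ∀ l, Module (WalledBrauer κ q ρ r s)ᵐᵒᵖ (C l)]
  D : LambdaRS r s → Type
  [instAddD : ∀ l, AddCommGroup (D l)]
  [instModD : ∀ l, Module (WalledBrauer κ q ρ r s)ᵐᵒᵖ (D l)]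
  [instModKC : ∀ l, Module κ (C l)]
  [instModKD : ∀ l, Module κ (D l)]
  kappaC : ∀ (l) (c : κ) (x : C l),
    c • x = (MulOpposite.op (algebraMap κ (WalledBrauer κ q ρ r s) c)) • x
  kappaD : ∀ (l) (c : κ) (x : D l),
    c • x = (MulOpposite.op (algebraMap κ (WalledBrauer κ q ρ r s) c)) • x
  quot : ∀ l, C l →ₗ[(WalledBrauer κ q ρ r s)ᵐᵒᵖ] D l
  quot_surjective : ∀ l, Function.Surjective (quot l)
  simple_of_restricted : ∀ l, ERestricted e l →
    IsSimpleModule (WalledBrauer κ q ρ r s)ᵐᵒᵖ (D l)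
  inj_on_restricted : ∀ l m, ERestricted e l → ERestricted e m →
    Nonempty (D l ≃ₗ[(WalledBrauer κ q ρ r s)ᵐᵒᵖ] D m) → l = m
  P : LambdaRS r s → Type
  [instAddP : ∀ l, AddCommGroup (P l)]
  [instModP : ∀ l, Module (WalledBrauer κ q ρ r s)ᵐᵒᵖ (P l)]
  [instModKP : ∀ l, Module κ (P l)]
  kappaP : ∀ (l) (c : κ) (x : P l),
    c • x = (MulOpposite.op (algebraMap κ (WalledBrauer κ q ρ r s) c)) • x
  P_projective : ∀ l, Module.Projective (WalledBrauer κ q ρ r s)ᵐᵒᵖ (P l)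
  P_cover : ∀ l, ∃ φ : P l →ₗ[(WalledBrauer κ q ρ r s)ᵐᵒᵖ] D l, Function.Surjective φ

attribute [instance] CellDatum.instAddC CellDatum.instModC CellDatum.instAddD CellDatum.instModD
  CellDatum.instModKC CellDatum.instModKD CellDatum.instAddP CellDatum.instModP
  CellDatum.instModKP

/-- Cell linkage in the sense of Graham–Lehrer: `(f,λ)` and `(ℓ,μ)` are cell linked
if `D^{f,λ}` is a composition factor of `C(ℓ,μ)` or `D^{ℓ,μ}` one of `C(f,λ)`. -/
def CellLinked {κ : Type} [Field κ] {q ρ : κˣ} {r s : ℕ} {e : ℕ∞}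
    (cd : CellDatum κ q ρ r s e) (l m : LambdaRS r s) : Prop :=
  IsCompositionFactor (WalledBrauer κ q ρ r s)ᵐᵒᵖ (cd.C l) (cd.D m) ∨
    IsCompositionFactor (WalledBrauer κ q ρ r s)ᵐᵒᵖ (cd.C m) (cd.D l)

/-- `C(f,λ)` and `C(ℓ,μ)` lie in the same block: the equivalence relation
generated by cell linkage. -/
def SameBlock {κ : Type} [Field κ] {q ρ : κˣ} {r s : ℕ} {e : ℕ∞}
    (cd : CellDatum κ q ρ r s e) (l m : LambdaRS r s) : Prop :=
  Relation.EqvGen (CellLinked cd) l m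

/-! ### Weights for statement 3 -/

/-- The weight `φ(f,λ) = (λ⁽¹⁾₁,…,λ⁽¹⁾_k, 0,…,0, -λ⁽²⁾_l,…,-λ⁽²⁾₁) ∈ ℤⁿ`. -/
noncomputable def phiW (n r s : ℕ) (l : LambdaRS r s) : Fin n → ℤ :=
  fun i => (partRow l.lam1 (i : ℕ) : ℤ) - (partRow l.lam2 (n - 1 - (i : ℕ)) : ℤ)

/-- The set `Λ(r,s)` of weights of `V^{r,s}`: vectors whose positive parts sum to `r - f`
and whose negative parts sum to `f - s` for some `0 ≤ f ≤ min r s`. -/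
def LambdaWeightSet (n r s : ℕ) : Set (Fin n → ℤ) :=
  {v | ∃ f : ℕ, f ≤ min r s ∧ (∑ i, max (v i) 0) = (r : ℤ) - (f : ℤ) ∧
    (∑ i, min (v i) 0) = (f : ℤ) - (s : ℤ)}

/-- The dominant weights `X⁺(n)`: weakly decreasing integer vectors. -/
def DominantSet (n : ℕ) : Set (Fin n → ℤ) := {v | ∀ i j : Fin n, i ≤ j → v j ≤ v i}

/-- Partial sums `v₁ + ⋯ + v_{i+1}`. -/
def psum {n : ℕ} (v : Fin n → ℤ) (i : Fin n) : ℤ := ∑ j : Fin n, if j ≤ i then v j else 0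

/-- The dominance order: `v ⊴ w` iff all partial sums of `v` are at most those of `w`
and the total sums agree. -/
def DomLE {n : ℕ} (v w : Fin n → ℤ) : Prop :=
  (∑ i, v i) = (∑ i, w i) ∧ ∀ i : Fin n, psum v i ≤ psum w i

/-- `Λ⁺(n,m)`, partitions of `m` with at most `n` parts, viewed as dominant nonnegative
integer vectors with entry sum `m`. -/
def PartitionVecSet (n m : ℕ) : Set (Fin n → ℤ) :=
  {v | v ∈ DominantSet n ∧ (∀ i, 0 ≤ v i) ∧ (∑ i, v i) = (m : ℤ)}

/-- `Λ = {λ + sω : λ ∈ Λ⁺(r,s)}` with `ω = (1,…,1)`. -/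
def ShiftedLambda (n r s : ℕ) : Set (Fin n → ℤ) :=
  {v | ∃ u ∈ LambdaWeightSet n r s ∩ DominantSet n, v = u + fun _ => (s : ℤ)}

/-- The rows of a partition in weakly decreasing order. -/
noncomputable def rowList {m : ℕ} (p : m.Partition) : List ℕ :=
  (p.parts.sort (· ≤ ·)).reverse

theorem coe_rowList {m : ℕ} (p : m.Partition) : (rowList p : Multiset ℕ) = p.parts := by
  rw [rowList, Multiset.coe_reverse, Multiset.sort_eq]

theorem rowList_pairwise {m : ℕ} (p : m.Partition) : (rowList p).Pairwise (· ≥ ·) := by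
  rw [rowList, List.pairwise_reverse]
  exact p.parts.pairwise_sort (· ≤ ·)

theorem partRow_eq_getD {m : ℕ} (p : m.Partition) (i : ℕ) :
    partRow p i = (rowList p).getD i 0 := rfl

theorem length_rowList_le {m : ℕ} (p : m.Partition) : (rowList p).length ≤ m := by
  have hsum : (rowList p).sum = m := by
    rw [← Multiset.sum_coe, coe_rowList, p.parts_sum]
  have hpos : ∀ a ∈ rowList p, 1 ≤ a := fun a ha =>
    p.parts_pos (by rw [← coe_rowList]; exact ha)
  simpa [hsum] using List.card_nsmul_le_sum (rowList p) 1 hpos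

theorem partRow_eq_zero {m : ℕ} (p : m.Partition) {i : ℕ} (hi : m ≤ i) : partRow p i = 0 := by
  rw [partRow_eq_getD]
  exact List.getD_eq_default _ _ ((length_rowList_le p).trans hi)

theorem partRow_antitone {m : ℕ} (p : m.Partition) : Antitone (partRow p) := by
  intro i j hij
  rw [partRow_eq_getD, partRow_eq_getD]
  by_cases hj : j < (rowList p).length
  · rw [List.getD_eq_getElem _ _ hj, List.getD_eq_getElem _ _ (hij.trans_lt hj)]
    rcases hij.eq_or_lt with rfl | h
    · rfl
    · exact List.pairwise_iff_getElem.1 (rowList_pairwise p) i j _ hj h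
  · rw [List.getD_eq_default _ _ (not_lt.1 hj)]
    exact Nat.zero_le _

theorem map_partRow_range {m : ℕ} (p : m.Partition) {N : ℕ} (hN : m ≤ N) :
    (List.range N).map (partRow p) =
      rowList p ++ List.replicate (N - (rowList p).length) 0 := by
  have hl := (length_rowList_le p).trans hN
  apply List.ext_getElem
  · simp; omega
  · intro i h1 h2
    simp only [List.getElem_map, List.getElem_range, partRow_eq_getD]
    by_cases hi : i < (rowList p).length
    · rw [List.getD_eq_getElem _ _ hi, List.getElem_append_left hi]
    · rw [List.getD_eq_default _ _ (not_lt.1 hi), List.getElem_append_right (not_lt.1 hi)]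
      simp

theorem sum_partRow {m : ℕ} (p : m.Partition) {N : ℕ} (hN : m ≤ N) :
    ∑ i ∈ Finset.range N, partRow p i = m := by
  have h : ∑ i ∈ Finset.range N, partRow p i = ((List.range N).map (partRow p)).sum := rfl
  rw [h, map_partRow_range p hN, List.sum_append, ← Multiset.sum_coe, coe_rowList, p.parts_sum]
  simp

theorem partRow_injective {m : ℕ} : Function.Injective (partRow (m := m)) := by
  intro p q h
  have hmap := map_partRow_range p le_rfl
  rw [h, map_partRow_range q le_rfl] at hmap
  have hfil := congrArg (List.filter (fun a => 0 < a)) hmap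
  have hself : ∀ t : m.Partition, (rowList t).filter (fun a => 0 < a) = rowList t := fun t =>
    List.filter_eq_self.2 fun a ha => by
      simpa using t.parts_pos (by rw [← coe_rowList]; exact ha)
  simp only [List.filter_append, hself] at hfil
  have hz : ∀ k, (List.replicate k 0).filter (fun a : ℕ => decide (0 < a)) = [] := by simp
  rw [hz, hz, List.append_nil, List.append_nil] at hfil
  apply Nat.Partition.ext
  rw [← coe_rowList, ← coe_rowList, hfil]

/-- Every weakly decreasing, eventually zero sequence is the sequence of rows of a partition. -/
theorem exists_partRow_eq {a : ℕ → ℕ} (ha : Antitone a) {N m : ℕ} (hN : a N = 0)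
    (hsum : ∑ i ∈ Finset.range N, a i = m) : ∃ p : m.Partition, partRow p = a := by
  classical
  have hex : ∃ k, a k = 0 := ⟨N, hN⟩
  set k := Nat.find hex
  have hpos : ∀ i < k, 0 < a i := fun i hi => Nat.pos_of_ne_zero (Nat.find_min hex hi)
  have hzero : ∀ i, k ≤ i → a i = 0 := fun i hi =>
    Nat.le_zero.1 ((ha hi).trans_eq (Nat.find_spec hex))
  have hkN : k ≤ N := Nat.find_min' hex hN
  have hsum' : ((List.range k).map a).sum = m := by
    change ∑ i ∈ Finset.range k, a i = m
    rw [← hsum]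
    refine Finset.sum_subset (Finset.range_mono hkN) fun i _ hi => hzero i ?_
    simpa using hi
  let p : m.Partition :=
    { parts := ((List.range k).map a : List ℕ)
      parts_pos := by
        intro x hx
        obtain ⟨i, hi, rfl⟩ := List.mem_map.1 (Multiset.mem_coe.1 hx)
        exact hpos i (List.mem_range.1 hi)
      parts_sum := by rw [Multiset.sum_coe, hsum'] }
  refine ⟨p, ?_⟩
  have hrow : rowList p = (List.range k).map a := by
    refine List.Perm.eq_of_pairwise' (r := (· ≥ ·)) (rowList_pairwise p) ?_
      (Multiset.coe_eq_coe.1 (coe_rowList p))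
    rw [List.pairwise_map]
    exact List.pairwise_lt_range.imp fun h => ha h.le
  funext i
  rw [partRow_eq_getD, hrow]
  by_cases hi : i < k
  · rw [List.getD_eq_getElem _ _ (by simpa using hi)]
    simp
  · rw [List.getD_eq_default _ _ (by simpa using hi), hzero i (not_lt.1 hi)]

section PhiW

variable {n r s : ℕ}

theorem max_phiW (hn : r + s ≤ n) (l : LambdaRS r s) (i : Fin n) :
    max (phiW n r s l i) 0 = partRow l.lam1 i := by
  by_cases hi : r - l.f ≤ i
  · simp [phiW, partRow_eq_zero l.lam1 hi]
  · have h2 : partRow l.lam2 (n - 1 - i) = 0 := partRow_eq_zero _ (by omega)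
    simp [phiW, h2]

theorem min_phiW (hn : r + s ≤ n) (l : LambdaRS r s) (i : Fin n) :
    min (phiW n r s l i) 0 = -(partRow l.lam2 (n - 1 - i) : ℤ) := by
  have h := min_add_max (phiW n r s l i) 0
  rw [max_phiW hn] at h
  simp only [phiW] at h ⊢
  linarith

theorem sum_fin_reflect (g : ℕ → ℤ) :
    ∑ i : Fin n, g (n - 1 - i) = ∑ i ∈ Finset.range n, g i := by
  rw [Fin.sum_univ_eq_sum_range (fun i => g (n - 1 - i)), Finset.sum_range_reflect]

theorem phiW_injective (hn : r + s ≤ n) : Function.Injective (phiW n r s) := by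
  intro l l' h
  have h1 : partRow l.lam1 = partRow l'.lam1 := by
    funext i
    by_cases hi : i < n
    · have := max_phiW hn l ⟨i, hi⟩
      rw [h, max_phiW hn] at this
      exact_mod_cast this.symm
    · rw [partRow_eq_zero _ (by omega), partRow_eq_zero _ (by omega)]
  have h2 : partRow l.lam2 = partRow l'.lam2 := by
    funext i
    by_cases hi : i < n
    · have := min_phiW hn l ⟨n - 1 - i, by omega⟩
      rw [h, min_phiW hn] at this
      have hni : n - 1 - (n - 1 - i) = i := by omega
      simp only [hni, neg_inj] at this
      exact_mod_cast this.symm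
    · rw [partRow_eq_zero _ (by omega), partRow_eq_zero _ (by omega)]
  have hf : l.f = l'.f := by
    have e := sum_partRow l.lam1 (N := n) (by omega)
    rw [h1, sum_partRow l'.lam1 (by omega)] at e
    have := l.hf
    have := l'.hf
    omega
  obtain ⟨f, hf1, p, q⟩ := l
  obtain ⟨f', hf2, p', q'⟩ := l'
  obtain rfl : f = f' := hf
  obtain rfl : p = p' := partRow_injective h1
  obtain rfl : q = q' := partRow_injective h2
  rfl

theorem phiW_mem (hn : r + s ≤ n) (l : LambdaRS r s) :
    phiW n r s l ∈ LambdaWeightSet n r s ∩ DominantSet n := by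
  have hf := l.hf
  refine ⟨⟨l.f, hf, ?_, ?_⟩, fun i j hij => ?_⟩
  · simp only [max_phiW hn]
    rw [Fin.sum_univ_eq_sum_range (fun i => (partRow l.lam1 i : ℤ)), ← Nat.cast_sum,
      sum_partRow _ (by omega)]
    omega
  · simp only [min_phiW hn]
    rw [Finset.sum_neg_distrib, sum_fin_reflect (fun i => (partRow l.lam2 i : ℤ)),
      ← Nat.cast_sum, sum_partRow _ (by omega)]
    omega
  · have hij' : (i : ℕ) ≤ j := hij
    have h1 := partRow_antitone l.lam1 hij'
    have h2 := partRow_antitone l.lam2 (show n - 1 - (j : ℕ) ≤ n - 1 - i by omega)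
    simp only [phiW]
    omega

theorem exists_phiW_eq {v : Fin n → ℤ} (hv : v ∈ LambdaWeightSet n r s)
    (hd : v ∈ DominantSet n) : ∃ l, phiW n r s l = v := by
  obtain ⟨f, hf, hpos, hneg⟩ := hv
  let a : ℕ → ℕ := fun i => if h : i < n then (v ⟨i, h⟩).toNat else 0
  let b : ℕ → ℕ := fun i => if h : i < n then (-v ⟨n - 1 - i, by omega⟩).toNat else 0
  have ha : Antitone a := by
    intro i j hij
    simp only [a]
    split_ifs with h1 h2
    · exact Int.toNat_le_toNat (hd _ _ hij)
    · omega
    · exact Nat.zero_le _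
    · rfl
  have hb : Antitone b := by
    intro i j hij
    simp only [b]
    split_ifs with h1 h2
    · refine Int.toNat_le_toNat (neg_le_neg (hd _ _ ?_))
      rw [Fin.mk_le_mk]
      omega
    · omega
    · exact Nat.zero_le _
    · rfl
  have hb' : ∀ i : Fin n, b (n - 1 - i) = (-v i).toNat := by
    intro i
    have h : n - 1 - (n - 1 - (i : ℕ)) = i := by omega
    simp only [b, h]
    exact dif_pos (by omega)
  have hasum : ∑ i ∈ Finset.range n, a i = r - f := by
    have : ((∑ i ∈ Finset.range n, a i : ℕ) : ℤ) = r - f := by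
      rw [← hpos, Nat.cast_sum, ← Fin.sum_univ_eq_sum_range (fun i => (a i : ℤ))]
      exact Finset.sum_congr rfl fun i _ => by simp [a, Int.ofNat_toNat]
    omega
  have hbsum : ∑ i ∈ Finset.range n, b i = s - f := by
    have : ((∑ i ∈ Finset.range n, b i : ℕ) : ℤ) = s - f := by
      rw [← neg_sub, ← hneg, Nat.cast_sum, ← sum_fin_reflect (fun i => (b i : ℤ)),
        ← Finset.sum_neg_distrib]
      exact Finset.sum_congr rfl fun i _ => by rw [hb', Int.ofNat_toNat]; omega
    omega
  obtain ⟨p, hp⟩ := exists_partRow_eq ha (N := n) (by simp [a]) hasum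
  obtain ⟨q, hq⟩ := exists_partRow_eq hb (N := n) (by simp [b]) hbsum
  refine ⟨⟨f, hf, p, q⟩, funext fun i => ?_⟩
  simp only [phiW, hp, hq, hb']
  simp only [a, Fin.is_lt, dite_true, Fin.eta]
  omega

end PhiW

theorem psum_le_sum_max {n : ℕ} (v : Fin n → ℤ) (i : Fin n) :
    psum v i ≤ ∑ j, max (v j) 0 := by
  refine Finset.sum_le_sum fun j _ => ?_
  split_ifs
  · exact le_max_left _ _
  · exact le_max_right _ _

/-- The positive parts of a dominant vector add up to zero or to one of its partial sums. -/
theorem sum_max_eq_zero_or_psum {n : ℕ} {v : Fin n → ℤ} (hv : v ∈ DominantSet n) :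
    ∑ j, max (v j) 0 = 0 ∨ ∃ i, ∑ j, max (v j) 0 = psum v i := by
  by_cases h : ∃ i, 0 < v i
  · right
    have hne : (Finset.univ.filter fun i => 0 < v i).Nonempty := by
      simpa [Finset.Nonempty] using h
    obtain ⟨i, hi, hmax⟩ := Finset.exists_max_image _ id hne
    simp only [Finset.mem_filter, Finset.mem_univ, true_and, id] at hi hmax
    refine ⟨i, Finset.sum_congr rfl fun j _ => ?_⟩
    split_ifs with hj
    · exact max_eq_left (hi.le.trans (hv _ _ hj))
    · exact max_eq_right (not_lt.1 fun h' => hj (hmax j h'))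
  · left
    push Not at h
    exact Finset.sum_eq_zero fun j _ => max_eq_right (h j)

theorem psum_sub_const_le {n : ℕ} {v w : Fin n → ℤ} (c : ℤ) {i : Fin n}
    (h : psum v i ≤ psum w i) : psum (fun j => v j - c) i ≤ psum (fun j => w j - c) i := by
  have key : ∀ u : Fin n → ℤ,
      psum (fun j => u j - c) i = psum u i - ∑ j : Fin n, if j ≤ i then c else 0 := by
    intro u
    simp only [psum, ← Finset.sum_sub_distrib]
    exact Finset.sum_congr rfl fun j _ => by split_ifs <;> simp
  rw [key, key]
  exact sub_le_sub_right h _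

theorem shiftedLambda_isIdeal {r s n : ℕ} (hn : 0 < n) {μ α : Fin n → ℤ}
    (hμ : μ ∈ ShiftedLambda n r s) (hα : α ∈ PartitionVecSet n (r + (n - 1) * s))
    (hle : DomLE α μ) : α ∈ ShiftedLambda n r s := by
  obtain ⟨u, ⟨⟨f, hf, hpos, -⟩, -⟩, rfl⟩ := hμ
  obtain ⟨hd, -, hsum⟩ := hα
  set β : Fin n → ℤ := fun j => α j - s with hβ
  have hβd : β ∈ DominantSet n := fun i j hij => sub_le_sub_right (hd i j hij) _
  have hβsum : ∑ j, max (β j) 0 + ∑ j, min (β j) 0 = (r : ℤ) - s := by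
    rw [← Finset.sum_add_distrib]
    simp only [max_add_min, add_zero, hβ, Finset.sum_sub_distrib, hsum]
    obtain ⟨k, rfl⟩ := Nat.exists_eq_succ_of_ne_zero hn.ne'
    simp
    ring
  have hmax0 : 0 ≤ ∑ j, max (β j) 0 := Finset.sum_nonneg fun j _ => le_max_right _ _
  have hmin0 : ∑ j, min (β j) 0 ≤ 0 := Finset.sum_nonpos fun j _ => min_le_right _ _
  have hmax : ∑ j, max (β j) 0 ≤ r := by
    rcases sum_max_eq_zero_or_psum hβd with h | ⟨i, h⟩
    · omega
    · have h1 := psum_sub_const_le (s : ℤ) (hle.2 i)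
      have h2 : (fun j => (u + fun _ => (s : ℤ) : Fin n → ℤ) j - s) = u := by
        funext j
        simp
      rw [h2] at h1
      have h3 := psum_le_sum_max u i
      have h4 : psum β i ≤ psum u i := h1
      omega
  refine ⟨β, ⟨⟨(r - ∑ j, max (β j) 0).toNat, ?_, ?_, ?_⟩, hβd⟩, ?_⟩
  · omega
  · omega
  · omega
  · funext j
    simp [hβ]

/-- Lemma 4.3 of the paper. Let `r, s, n` be positive integers with
`n ≥ r + s`. (a) The map `φ` is a bijection from `Λ_{r,s}` onto
`Λ⁺(r,s) = Λ(r,s) ∩ X⁺(n)`. (b) The set `Λ = {λ + sω : λ ∈ Λ⁺(r,s)}` is an ideal of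
`Λ⁺(n, r+(n-1)s)` under the dominance order: if `μ ∈ Λ`, `α ∈ Λ⁺(n, r+(n-1)s)` and
`α ⊴ μ`, then `α ∈ Λ`. -/
theorem phiW_bijective_and_shifted_is_ideal
    (r s n : ℕ) (hr : 0 < r) (hs : 0 < s) (hn : r + s ≤ n) :
    (Function.Injective (phiW n r s) ∧
      Set.range (phiW n r s) = LambdaWeightSet n r s ∩ DominantSet n) ∧
    (∀ μ α : Fin n → ℤ, μ ∈ ShiftedLambda n r s →
      α ∈ PartitionVecSet n (r + (n - 1) * s) → DomLE α μ → α ∈ ShiftedLambda n r s) := by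
  refine ⟨⟨phiW_injective hn, Set.Subset.antisymm ?_ ?_⟩, fun μ α hμ hα hle =>
    shiftedLambda_isIdeal (by omega) hμ hα hle⟩
  · rintro _ ⟨l, rfl⟩
    exact phiW_mem hn l
  · rintro v ⟨hv, hd⟩
    exact exists_phiW_eq hv hd
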